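/- arXiv:1711.11215 — 4 statements merged into one kernel-verified Lean document; each statement's English description precedes it below -/
import Mathlib

section
/- Fix δ ∈ (1/2, ∞) and SNR > 0, and let τ* be the unique positive minimizer of F. Then Q(√(δ·SNR)) < Q(1/τ*) ≤ Q(√((δ − 1/2)·SNR)). -/
open Real

/-- The standard normal tail function `Q(x) = ∫_x^∞ (2π)^{-1/2} e^{-t²/2} dt`. -/
noncomputable def Qfun (x : ℝ) : ℝ :=
  ∫ t in Set.Ioi x, (Real.sqrt (2 * Real.pi))⁻¹ * Real.exp (-t ^ 2 / 2)

/-- The function `F` from the paper, with parameters `δ` and `SNR`. -/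
noncomputable def Ffun (δ SNR τ : ℝ) : ℝ :=
  τ * (δ - 1 / 2) + (1 / SNR) / τ + (τ + 4 / τ) * Qfun (2 / τ)
    - Real.sqrt (2 / Real.pi) * Real.exp (-2 / τ ^ 2)

/-- The standard normal density. -/
noncomputable def gaussDensity (x : ℝ) : ℝ :=
  (Real.sqrt (2 * Real.pi))⁻¹ * Real.exp (-x ^ 2 / 2)

lemma gaussDensity_pos (x : ℝ) : 0 < gaussDensity x := by
  unfold gaussDensity; positivity

lemma continuous_gaussDensity : Continuous gaussDensity := by
  unfold gaussDensity; fun_prop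

lemma hasDerivAt_gaussDensity (x : ℝ) :
    HasDerivAt gaussDensity (-(x * gaussDensity x)) x := by
  have h : HasDerivAt (fun y : ℝ => -y ^ 2 / 2) (-x) x := by
    convert! ((hasDerivAt_pow 2 x).neg.div_const 2) using 1
    push_cast; ring
  convert! h.exp.const_mul (Real.sqrt (2 * Real.pi))⁻¹ using 1
  unfold gaussDensity; ring

lemma integrable_gaussDensity : MeasureTheory.Integrable gaussDensity := by
  have h := (integrable_exp_neg_mul_sq (b := 1 / 2) (by norm_num)).const_mul
    (Real.sqrt (2 * Real.pi))⁻¹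
  refine h.congr (.of_forall fun x => ?_)
  simp only [gaussDensity]; ring_nf

lemma integrable_id_mul_gaussDensity :
    MeasureTheory.Integrable fun x => x * gaussDensity x := by
  have h := (integrable_mul_exp_neg_mul_sq (b := 1 / 2) (by norm_num)).const_mul
    (Real.sqrt (2 * Real.pi))⁻¹
  refine h.congr (.of_forall fun x => ?_)
  simp only [gaussDensity]; ring_nf

lemma Qfun_eq (x : ℝ) : Qfun x = ∫ t in Set.Ioi x, gaussDensity t := rfl

lemma hasDerivAt_Qfun (x : ℝ) : HasDerivAt Qfun (-gaussDensity x) x := by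
  have h : Qfun = fun y => Qfun 0 - ∫ t in (0 : ℝ)..y, gaussDensity t := by
    funext y
    rw [← intervalIntegral.integral_Ioi_sub_Ioi' integrable_gaussDensity.integrableOn
      integrable_gaussDensity.integrableOn, Qfun_eq, Qfun_eq]
    ring
  rw [h]
  exact (continuous_gaussDensity.integral_hasStrictDerivAt 0 x).hasDerivAt.const_sub _

lemma Qfun_strictAnti : StrictAnti Qfun :=
  strictAnti_of_deriv_neg fun x => by
    rw [(hasDerivAt_Qfun x).deriv]; exact neg_neg_of_pos (gaussDensity_pos x)

lemma Qfun_pos (x : ℝ) : 0 < Qfun x :=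
  (MeasureTheory.integral_nonneg fun t => (gaussDensity_pos t).le).trans_lt
    (Qfun_strictAnti (lt_add_one x))

lemma Qfun_zero : Qfun 0 = 1 / 2 := by
  have h : Qfun 0 = (Real.sqrt (2 * Real.pi))⁻¹ *
      ∫ t in Set.Ioi (0 : ℝ), Real.exp (-(1 / 2) * t ^ 2) := by
    rw [← MeasureTheory.integral_const_mul]
    unfold Qfun
    congr 1; funext t; ring_nf
  rw [h, integral_gaussian_Ioi, show Real.pi / (1 / 2) = 2 * Real.pi by ring]
  have : Real.sqrt (2 * Real.pi) ≠ 0 := by positivity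
  field_simp

lemma mul_Qfun_le_gaussDensity (u : ℝ) : u * Qfun u ≤ gaussDensity u := by
  have hint := (integrable_id_mul_gaussDensity.integrableOn (s := Set.Ioi u))
  have hlim : Filter.Tendsto gaussDensity Filter.atTop (nhds 0) :=
    MeasureTheory.tendsto_zero_of_hasDerivAt_of_integrableOn_Ioi (a := u)
      (fun x _ => hasDerivAt_gaussDensity x) hint.neg integrable_gaussDensity.integrableOn
  have hval := MeasureTheory.integral_Ioi_of_hasDerivAt_of_tendsto' (a := u)
    (fun x _ => hasDerivAt_gaussDensity x) hint.neg hlim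
  rw [MeasureTheory.integral_neg] at hval
  have hle : ∫ t in Set.Ioi u, u * gaussDensity t ≤ ∫ t in Set.Ioi u, t * gaussDensity t :=
    MeasureTheory.setIntegral_mono_on (integrable_gaussDensity.integrableOn.const_mul u) hint
      measurableSet_Ioi fun t ht =>
        mul_le_mul_of_nonneg_right (le_of_lt ht) (gaussDensity_pos t).le
  rw [MeasureTheory.integral_const_mul, ← Qfun_eq] at hle
  linarith

lemma one_sub_sq_mul_Qfun_add_nonneg {u : ℝ} (hu : 0 ≤ u) :
    0 ≤ (1 - u ^ 2) * Qfun u + u * gaussDensity u := by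
  have h := mul_le_mul_of_nonneg_left (mul_Qfun_le_gaussDensity u) hu
  have h' := Qfun_pos u
  nlinarith

lemma one_sub_sq_mul_Qfun_add_lt_half {u : ℝ} (hu : 0 < u) :
    (1 - u ^ 2) * Qfun u + u * gaussDensity u < 1 / 2 := by
  have hd : ∀ x : ℝ, HasDerivAt (fun y => (1 - y ^ 2) * Qfun y + y * gaussDensity y)
      (-(2 * x * Qfun x)) x := by
    intro x
    convert! (((hasDerivAt_pow 2 x).const_sub 1).mul (hasDerivAt_Qfun x)).add
      ((hasDerivAt_id x).mul (hasDerivAt_gaussDensity x)) using 1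
    simp only [id]
    push_cast
    ring
  have hanti : StrictAntiOn (fun y => (1 - y ^ 2) * Qfun y + y * gaussDensity y)
      (Set.Ici 0) := by
    refine strictAntiOn_of_deriv_neg (convex_Ici 0)
      (fun x _ => (hd x).continuousAt.continuousWithinAt) fun x hx => ?_
    rw [interior_Ici, Set.mem_Ioi] at hx
    have := Qfun_pos x
    rw [(hd x).deriv]
    exact neg_neg_of_pos (by positivity)
  have h := hanti Set.self_mem_Ici hu.le hu
  simpa [Qfun_zero] using h

lemma sqrt_mul_exp_eq_gaussDensity (τ : ℝ) :
    Real.sqrt (2 / Real.pi) * Real.exp (-2 / τ ^ 2) = 2 * gaussDensity (2 / τ) := by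
  unfold gaussDensity
  have h : Real.sqrt (2 / Real.pi) = 2 * (Real.sqrt (2 * Real.pi))⁻¹ := by
    rw [Real.sqrt_div (by norm_num), Real.sqrt_mul (by norm_num)]
    have := Real.sq_sqrt (show (0 : ℝ) ≤ 2 by norm_num)
    field_simp
    linarith
  rw [h, show -(2 / τ) ^ 2 / 2 = -2 / τ ^ 2 by ring, mul_assoc]

lemma hasDerivAt_Ffun (δ SNR : ℝ) {τ : ℝ} (hτ : τ ≠ 0) :
    HasDerivAt (Ffun δ SNR)
      (δ - 1 / 2 - (1 / τ) ^ 2 / SNR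
        + ((1 - (2 / τ) ^ 2) * Qfun (2 / τ) + 2 / τ * gaussDensity (2 / τ))) τ := by
  have hF : Ffun δ SNR = fun t => t * (δ - 1 / 2) + (1 / SNR) * t⁻¹
      + (t + 4 * t⁻¹) * Qfun (2 * t⁻¹) - 2 * gaussDensity (2 * t⁻¹) := by
    funext t
    rw [Ffun, sqrt_mul_exp_eq_gaussDensity]
    simp only [div_eq_mul_inv]
  have hinv := hasDerivAt_inv hτ
  have hu := hinv.const_mul 2
  rw [hF]
  convert! ((((hasDerivAt_id τ).mul_const (δ - 1 / 2)).add (hinv.const_mul (1 / SNR))).add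
    (((hasDerivAt_id τ).add (hinv.const_mul 4)).mul
      ((hasDerivAt_Qfun (2 * τ⁻¹)).comp τ hu))).sub
    (((hasDerivAt_gaussDensity (2 * τ⁻¹)).comp τ hu).const_mul 2) using 1
  simp only [id, Function.comp, Pi.add_apply, div_eq_mul_inv]
  field_simp
  ring

theorem stmt5 (δ SNR : ℝ) (hδ : 1 / 2 < δ) (hSNR : 0 < SNR)
    (τs : ℝ) (hτs : 0 < τs)
    (hmin : ∀ τ : ℝ, 0 < τ → Ffun δ SNR τs ≤ Ffun δ SNR τ) :
    Qfun (Real.sqrt (δ * SNR)) < Qfun (1 / τs) ∧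
      Qfun (1 / τs) ≤ Qfun (Real.sqrt ((δ - 1 / 2) * SNR)) := by
  have hloc : IsLocalMin (Ffun δ SNR) τs := by
    filter_upwards [lt_mem_nhds hτs] with τ hτ using hmin τ hτ
  have hstat := hloc.hasDerivAt_eq_zero (hasDerivAt_Ffun δ SNR hτs.ne')
  have hu : 0 < 2 / τs := by positivity
  have h0 := one_sub_sq_mul_Qfun_add_nonneg hu.le
  have h1 := one_sub_sq_mul_Qfun_add_lt_half hu
  refine ⟨Qfun_strictAnti (Real.lt_sqrt_of_sq_lt ?_),
    Qfun_strictAnti.antitone ((Real.sqrt_le_left (by positivity)).2 ?_)⟩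
  · rw [← div_lt_iff₀ hSNR]
    linarith
  · rw [← le_div_iff₀ hSNR]
    linarith
end

section
/- Fix δ ∈ (1/2, ∞) and SNR > 0, and define F : (0, ∞) → ℝ by F(τ) = τ(δ − 1/2) + (1/SNR)/τ + (τ + 4/τ)·Q(2/τ) − √(2/π)·e^{−2/τ²}. Then F is strictly convex on (0, ∞) and there exists a unique τ* ∈ (0, ∞) such that F(τ*) ≤ F(τ) for all τ ∈ (0, ∞), with strict inequality for τ ≠ τ*. -/
open Real

open MeasureTheory Set in
theorem hasDerivAt_Qfun_s6 (x : ℝ) :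
    HasDerivAt Qfun (-((√(2 * π))⁻¹ * exp (-x ^ 2 / 2))) x := by
  have hint : Integrable (fun t : ℝ => (√(2 * π))⁻¹ * exp (-t ^ 2 / 2)) := by
    convert (integrable_exp_neg_mul_sq (b := 1 / 2) (by norm_num)).const_mul _ using 5
    ring
  have hcont : Continuous fun t : ℝ => (√(2 * π))⁻¹ * exp (-t ^ 2 / 2) := by fun_prop
  have heq : Qfun = fun y => Qfun 0 - ∫ t in (0 : ℝ)..y, (√(2 * π))⁻¹ * exp (-t ^ 2 / 2) := by
    funext y
    rw [← intervalIntegral.integral_Ioi_sub_Ioi' hint.integrableOn hint.integrableOn]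
    simp only [Qfun, sub_sub_cancel]
  rw [heq]
  exact (hcont.integral_hasStrictDerivAt 0 x).hasDerivAt.const_sub _

theorem Qfun_nonneg (x : ℝ) : 0 ≤ Qfun x :=
  MeasureTheory.integral_nonneg fun t => by positivity

theorem hasDerivAt_const_div (c : ℝ) {τ : ℝ} (hτ : τ ≠ 0) :
    HasDerivAt (fun τ : ℝ => c / τ) (-c / τ ^ 2) τ :=
  ((hasDerivAt_const τ c).div (hasDerivAt_id τ) hτ).congr_deriv (by simp)

theorem hasDerivAt_const_div_sq (c : ℝ) {τ : ℝ} (hτ : τ ≠ 0) :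
    HasDerivAt (fun τ : ℝ => c / τ ^ 2) (-2 * c / τ ^ 3) τ := by
  refine ((hasDerivAt_const τ c).div (hasDerivAt_pow 2 τ) (pow_ne_zero 2 hτ)).congr_deriv ?_
  field_simp
  push_cast
  ring

theorem hasDerivAt_Qfun_two_div {τ : ℝ} (hτ : τ ≠ 0) :
    HasDerivAt (fun τ => Qfun (2 / τ)) ((√(2 * π))⁻¹ * exp (-2 / τ ^ 2) * (2 / τ ^ 2)) τ := by
  refine ((hasDerivAt_Qfun_s6 (2 / τ)).comp τ (hasDerivAt_const_div 2 hτ)).congr_deriv ?_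
  have hexp : -(2 / τ) ^ 2 / 2 = -2 / τ ^ 2 := by ring
  rw [hexp]
  ring

theorem hasDerivAt_exp_neg_two_div_sq {τ : ℝ} (hτ : τ ≠ 0) :
    HasDerivAt (fun τ : ℝ => exp (-2 / τ ^ 2)) (exp (-2 / τ ^ 2) * (4 / τ ^ 3)) τ :=
  (hasDerivAt_const_div_sq (-2) hτ).exp.congr_deriv (by norm_num)

theorem sqrt_two_div_pi : √(2 / π) = 2 * (√(2 * π))⁻¹ := by
  rw [← Real.sqrt_inv, ← Real.sqrt_sq (zero_le_two (α := ℝ)), ← Real.sqrt_mul (by positivity),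
    Real.sqrt_sq zero_le_two]
  congr 1
  field_simp

/-- The derivative of `Ffun δ SNR` on the positive half-line. -/
noncomputable def derivFfun (δ SNR τ : ℝ) : ℝ :=
  (δ - 1 / 2) - (1 / SNR) / τ ^ 2 + (1 - 4 / τ ^ 2) * Qfun (2 / τ)
    + (√(2 * π))⁻¹ * exp (-2 / τ ^ 2) * (2 / τ)

theorem hasDerivAt_Ffun_s6 (δ SNR : ℝ) {τ : ℝ} (hτ : τ ≠ 0) :
    HasDerivAt (Ffun δ SNR) (derivFfun δ SNR τ) τ := by
  have h := ((((hasDerivAt_id τ).mul_const (δ - 1 / 2)).add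
    (hasDerivAt_const_div (1 / SNR) hτ)).add
    (((hasDerivAt_id τ).add (hasDerivAt_const_div 4 hτ)).mul (hasDerivAt_Qfun_two_div hτ))).sub
    ((hasDerivAt_exp_neg_two_div_sq hτ).const_mul √(2 / π))
  refine h.congr_deriv ?_
  simp only [derivFfun, sqrt_two_div_pi, Pi.add_apply, id]
  field_simp
  ring

theorem hasDerivAt_derivFfun (δ SNR : ℝ) {τ : ℝ} (hτ : τ ≠ 0) :
    HasDerivAt (derivFfun δ SNR) (2 * (1 / SNR) / τ ^ 3 + 8 / τ ^ 3 * Qfun (2 / τ)) τ := by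
  have h := (((hasDerivAt_const_div_sq (1 / SNR) hτ).const_sub (δ - 1 / 2)).add
    (((hasDerivAt_const_div_sq 4 hτ).const_sub 1).mul (hasDerivAt_Qfun_two_div hτ))).add
    (((hasDerivAt_exp_neg_two_div_sq hτ).const_mul (√(2 * π))⁻¹).mul (hasDerivAt_const_div 2 hτ))
  refine h.congr_deriv ?_
  generalize (√(2 * π))⁻¹ = s
  generalize 1 / SNR = a
  field_simp
  ring

theorem strictConvexOn_Ffun (δ : ℝ) {SNR : ℝ} (hSNR : 0 < SNR) :
    StrictConvexOn ℝ (Set.Ioi 0) (Ffun δ SNR) := by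
  refine StrictMonoOn.strictConvexOn_of_deriv (convex_Ioi 0)
    (fun τ hτ => (hasDerivAt_Ffun_s6 δ SNR hτ.ne').continuousAt.continuousWithinAt) ?_
  rw [interior_Ioi]
  have hmono : StrictMonoOn (derivFfun δ SNR) (Set.Ioi 0) := by
    refine strictMonoOn_of_deriv_pos (convex_Ioi 0)
      (fun τ hτ => (hasDerivAt_derivFfun δ SNR hτ.ne').continuousAt.continuousWithinAt) ?_
    intro τ hτ
    rw [interior_Ioi] at hτ
    have hτ : 0 < τ := hτ
    rw [(hasDerivAt_derivFfun δ SNR hτ.ne').deriv]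
    have := Qfun_nonneg (2 / τ)
    positivity
  exact hmono.congr fun τ hτ => (hasDerivAt_Ffun_s6 δ SNR hτ.ne').deriv.symm

theorem le_Ffun (δ SNR : ℝ) {τ : ℝ} (hτ : 0 < τ) :
    τ * (δ - 1 / 2) + (1 / SNR) / τ - √(2 / π) ≤ Ffun δ SNR τ := by
  have hQ : 0 ≤ (τ + 4 / τ) * Qfun (2 / τ) := mul_nonneg (by positivity) (Qfun_nonneg _)
  have hexp : exp (-2 / τ ^ 2) ≤ 1 :=
    exp_le_one_iff.2 (div_nonpos_of_nonpos_of_nonneg (by norm_num) (by positivity))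
  have := mul_le_mul_of_nonneg_left hexp (sqrt_nonneg (2 / π))
  unfold Ffun
  linarith

theorem exists_isMinOn_Ffun {δ SNR : ℝ} (hδ : 1 / 2 < δ) (hSNR : 0 < SNR) :
    ∃ τs ∈ Set.Ioi (0 : ℝ), IsMinOn (Ffun δ SNR) (Set.Ioi 0) τs := by
  set M := Ffun δ SNR 1 + √(2 / π)
  have hc : 0 < δ - 1 / 2 := by linarith
  have ha : 0 < 1 / SNR := by positivity
  have hM : 0 < M := by
    have := le_Ffun δ SNR one_pos
    simp only [M]
    linarith
  have hmem : ∀ τ, 0 < τ → Ffun δ SNR τ ≤ Ffun δ SNR 1 →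
      τ ∈ Set.Icc ((1 / SNR) / M) (M / (δ - 1 / 2)) := by
    intro τ hτ hle
    have hlow := le_Ffun δ SNR hτ
    have h₁ : 0 < τ * (δ - 1 / 2) := by positivity
    have h₂ : 0 < (1 / SNR) / τ := by positivity
    constructor
    · rw [div_le_comm₀ hM hτ]
      simp only [M]
      linarith
    · rw [le_div_iff₀ hc]
      simp only [M]
      linarith
  have hpos : ∀ τ ∈ Set.Icc ((1 / SNR) / M) (M / (δ - 1 / 2)), 0 < τ :=
    fun τ hτ => lt_of_lt_of_le (by positivity) hτ.1
  have hone := hmem 1 one_pos le_rfl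
  obtain ⟨τs, hτs, hmin⟩ := isCompact_Icc.exists_isMinOn ⟨1, hone⟩ (f := Ffun δ SNR)
    fun τ hτ => (hasDerivAt_Ffun_s6 δ SNR (hpos τ hτ).ne').continuousAt.continuousWithinAt
  refine ⟨τs, hpos τs hτs, fun τ hτ => ?_⟩
  rcases le_total (Ffun δ SNR τ) (Ffun δ SNR 1) with h | h
  · exact hmin (hmem τ hτ h)
  · exact (hmin hone).trans h

theorem stmt6 (δ SNR : ℝ) (hδ : 1 / 2 < δ) (hSNR : 0 < SNR) :
    StrictConvexOn ℝ (Set.Ioi (0 : ℝ)) (Ffun δ SNR) ∧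
      ∃! τs : ℝ, 0 < τs ∧ ∀ τ : ℝ, 0 < τ →
        (Ffun δ SNR τs ≤ Ffun δ SNR τ ∧ (τ ≠ τs → Ffun δ SNR τs < Ffun δ SNR τ)) := by
  have hconv := strictConvexOn_Ffun δ hSNR
  obtain ⟨τs, hτs, hmin⟩ := exists_isMinOn_Ffun hδ hSNR
  refine ⟨hconv, τs, ⟨hτs, fun τ hτ => ⟨hmin hτ, fun hne => ?_⟩⟩, fun σ hσ => ?_⟩
  · refine lt_of_le_of_ne (hmin hτ) fun heq => hne ?_
    exact hconv.eq_of_isMinOn (fun σ hσ => heq ▸ hmin hσ) hmin hτ hτs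
  · exact hconv.eq_of_isMinOn (fun τ hτ => (hσ.2 τ hτ).1) hmin hσ.1 hτs
end

section
/- Let p(h) = (2π)^{−1/2}·e^{−h²/2} denote the standard normal density. For α > 0 define υ(α; ·) : ℝ → ℝ by υ(α; h) = 0 if h ≥ 0, υ(α; h) = −(α/2)·h² if −2/α ≤ h < 0, and υ(α; h) = 2/α + 2h if h < −2/α. Then for every α > 0, the expectation of υ(α; H) for H a standard normal random variable satisfies E[υ(α; H)] = −α/4 + (α/2)·∫_{2/α}^{∞} (h − 2/α)²·p(h) dh. -/
open Real MeasureTheory ProbabilityTheory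

/-- The standard normal density `p(h) = (2π)^{-1/2} e^{-h²/2}`. -/
noncomputable def stdp (h : ℝ) : ℝ := (Real.sqrt (2 * Real.pi))⁻¹ * Real.exp (-h ^ 2 / 2)

/-- The function `υ(α; ·)` from the auxiliary optimization for BPSK. -/
noncomputable def upsilon (α h : ℝ) : ℝ :=
  if 0 ≤ h then 0 else if -2 / α ≤ h then -(α / 2) * h ^ 2 else 2 / α + 2 * h

lemma gaussianPDFReal_eq_stdp (h : ℝ) : gaussianPDFReal 0 1 h = stdp h := by
  simp [gaussianPDFReal, stdp]

lemma stdp_neg (h : ℝ) : stdp (-h) = stdp h := by simp [stdp]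

lemma integrable_gaussianReal_zero_one_iff (f : ℝ → ℝ) :
    Integrable f (gaussianReal 0 1) ↔ Integrable fun h => f h * stdp h := by
  rw [gaussianReal_of_var_ne_zero _ one_ne_zero,
    integrable_withDensity_iff (measurable_gaussianPDF 0 1)
      (Filter.Eventually.of_forall fun _ => ENNReal.ofReal_lt_top)]
  simp_rw [toReal_gaussianPDF, gaussianPDFReal_eq_stdp]

lemma integral_gaussianReal_zero_one (f : ℝ → ℝ) :
    ∫ h, f h ∂(gaussianReal 0 1) = ∫ h, f h * stdp h := by
  rw [integral_gaussianReal_eq_integral_smul one_ne_zero]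
  simp_rw [gaussianPDFReal_eq_stdp, smul_eq_mul, mul_comm]

lemma integrable_sub_sq_mul_stdp (c : ℝ) : Integrable fun h => (h - c) ^ 2 * stdp h := by
  rw [← integrable_gaussianReal_zero_one_iff fun h => (h - c) ^ 2]
  exact ((memLp_id_gaussianReal 2).sub (memLp_const c)).integrable_sq

lemma integral_sq_mul_stdp : ∫ h, h ^ 2 * stdp h = 1 := by
  rw [← integral_gaussianReal_zero_one fun h => h ^ 2]
  have h := variance_id_gaussianReal (μ := 0) (v := 1)
  rw [variance_eq_integral aemeasurable_id] at h
  simpa using h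

lemma setIntegral_Ioi_sq_mul_stdp : ∫ h in Set.Ioi 0, h ^ 2 * stdp h = 1 / 2 := by
  have h := integral_comp_abs (f := fun h => h ^ 2 * stdp h)
  have hp (x : ℝ) : |x| ^ 2 * stdp |x| = x ^ 2 * stdp x := by simp [stdp]
  simp_rw [hp, integral_sq_mul_stdp] at h
  linarith

lemma upsilon_neg_mul_stdp {α : ℝ} (hα : 0 < α) (h : ℝ) :
    upsilon α (-h) * stdp h =
      -(α / 2) * (Set.Ioi 0).indicator (fun h => h ^ 2 * stdp h) h +
        (α / 2) * (Set.Ioi (2 / α)).indicator (fun h => (h - 2 / α) ^ 2 * stdp h) h := by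
  have hc : 0 < 2 / α := by positivity
  simp only [upsilon, Set.indicator_apply, Set.mem_Ioi, neg_div, neg_le_neg_iff, Left.nonneg_neg_iff]
  rcases le_or_gt h 0 with h0 | h0
  · simp [h0, h0.not_gt, (h0.trans hc.le).not_gt]
  rcases le_or_gt h (2 / α) with h1 | h1
  · simp [h0, h0.not_ge, h1, h1.not_gt]
    ring
  · simp only [h0, h0.not_ge, h1, h1.not_ge, if_true, if_false]
    field_simp
    ring

theorem stmt17 (α : ℝ) (hα : 0 < α) :
    ∫ h, upsilon α h ∂(gaussianReal 0 1) =
      -α / 4 + (α / 2) * ∫ h in Set.Ioi (2 / α), (h - 2 / α) ^ 2 * stdp h := by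
  have hsq : Integrable fun h => h ^ 2 * stdp h := by simpa using integrable_sub_sq_mul_stdp 0
  rw [integral_gaussianReal_zero_one, ← integral_neg_eq_self]
  simp_rw [stdp_neg, upsilon_neg_mul_stdp hα]
  rw [integral_add ((hsq.indicator measurableSet_Ioi).const_mul _)
      (((integrable_sub_sq_mul_stdp _).indicator measurableSet_Ioi).const_mul _),
    integral_const_mul, integral_const_mul, integral_indicator measurableSet_Ioi,
    integral_indicator measurableSet_Ioi, setIntegral_Ioi_sq_mul_stdp]
  ring
end

section
/- Let n, m be positive integers, σ > 0 and δ > 0. Let g ∈ ℝ^m satisfy ‖g‖₂ ≥ (√δ/2)·√n, and let h ∈ ℝ^n be arbitrary. Define f : ℝ^n → ℝ by f(w) = √(‖w‖₂²/n + σ²)·(‖g‖₂/√n) − (1/n)·⟨h, w⟩. Then f is strongly convex on the cube [−2, 0]^n with modulus C/n, where C = σ²·√δ / (2·(σ² + 4)^{3/2}); that is, for all w, w′ ∈ [−2, 0]^n and t ∈ [0, 1], f(t·w + (1−t)·w′) ≤ t·f(w) + (1−t)·f(w′) − (C/(2n))·t·(1−t)·‖w − w′‖₂². -/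
open Finset

/-- If `A ^ 2 - B ^ 2 = u ^ 2 - v ^ 2` with `u`, `v` at most `k / L` times `A`, `B`, then
`|A - B|` is at most `k / L` times `|u - v|`. -/
lemma sq_sub_mul_le_of_sq_sub_le {u v A B L k D : ℝ} (hu : 0 ≤ u) (hv : 0 ≤ v) (hA : 0 < A)
    (hB : 0 < B) (hL : 0 ≤ L) (hAB : A ^ 2 - B ^ 2 = u ^ 2 - v ^ 2) (huA : u * L ≤ k * A)
    (hvB : v * L ≤ k * B) (hD : (u - v) ^ 2 ≤ D) :
    (A - B) ^ 2 * L ^ 2 ≤ k ^ 2 * D := by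
  have hpos : 0 < (A + B) ^ 2 := by positivity
  have hD0 : 0 ≤ D := (sq_nonneg _).trans hD
  have hsum : ((u + v) * L) ^ 2 ≤ (k * (A + B)) ^ 2 :=
    pow_le_pow_left₀ (by positivity) (by linarith) 2
  have heq : (A - B) ^ 2 * L ^ 2 * (A + B) ^ 2 = (u - v) ^ 2 * ((u + v) * L) ^ 2 := by
    calc (A - B) ^ 2 * L ^ 2 * (A + B) ^ 2 = (A ^ 2 - B ^ 2) ^ 2 * L ^ 2 := by ring
      _ = (u - v) ^ 2 * ((u + v) * L) ^ 2 := by rw [hAB]; ring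
  refine le_of_mul_le_mul_right ?_ hpos
  calc (A - B) ^ 2 * L ^ 2 * (A + B) ^ 2 = (u - v) ^ 2 * ((u + v) * L) ^ 2 := heq
    _ ≤ D * (k * (A + B)) ^ 2 := mul_le_mul hD hsum (sq_nonneg _) hD0
    _ = k ^ 2 * D * (A + B) ^ 2 := by ring

/-- The ratio `√x / √(x + s)` on `[0, k ^ 2]` is largest at `x = k ^ 2`. -/
lemma sqrt_mul_sqrt_le_mul_sqrt {x s k : ℝ} (hx : 0 ≤ x) (hs : 0 ≤ s) (hk : 0 ≤ k)
    (hxk : x ≤ k ^ 2) : √x * √(s + k ^ 2) ≤ k * √(x + s) := by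
  rw [← Real.sqrt_mul hx]
  refine Real.sqrt_le_iff.2 ⟨by positivity, ?_⟩
  rw [mul_pow, Real.sq_sqrt (by positivity)]
  nlinarith [mul_le_mul_of_nonneg_right hxk hs]

/-- Strong convexity of `w ↦ √(‖w‖ ^ 2 + s)` on the ball of radius `k`, in terms of the squared
norms `a`, `b` of two points and their inner product `c`. -/
lemma sqrt_add_le_sub_of_sq_le_mul {a b c s k t : ℝ} (ha : 0 ≤ a) (hb : 0 ≤ b) (hs : 0 < s)
    (hk : 0 ≤ k) (hak : a ≤ k ^ 2) (hbk : b ≤ k ^ 2) (hc : c ^ 2 ≤ a * b) (ht0 : 0 ≤ t)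
    (ht1 : t ≤ 1) :
    √(t ^ 2 * a + (1 - t) ^ 2 * b + 2 * t * (1 - t) * c + s) ≤
      t * √(a + s) + (1 - t) * √(b + s)
        - s / (2 * √(s + k ^ 2) ^ 3) * (t * (1 - t) * (a + b - 2 * c)) := by
  have huv : c ≤ √a * √b := by
    rw [← Real.sqrt_mul ha]; exact Real.le_sqrt_of_sq_le hc
  have hD : (√a - √b) ^ 2 ≤ a + b - 2 * c := by
    nlinarith [Real.sq_sqrt ha, Real.sq_sqrt hb]
  have hLpos : 0 < √(s + k ^ 2) := Real.sqrt_pos.2 (by positivity)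
  have hL2 : √(s + k ^ 2) ^ 2 = s + k ^ 2 := Real.sq_sqrt (by positivity)
  have hA2 : √(a + s) ^ 2 = a + s := Real.sq_sqrt (by positivity)
  have hB2 : √(b + s) ^ 2 = b + s := Real.sq_sqrt (by positivity)
  have hcontr := sq_sub_mul_le_of_sq_sub_le (Real.sqrt_nonneg a) (Real.sqrt_nonneg b)
    (Real.sqrt_pos.2 (by positivity : 0 < a + s)) (Real.sqrt_pos.2 (by positivity : 0 < b + s))
    hLpos.le (by rw [hA2, hB2, Real.sq_sqrt ha, Real.sq_sqrt hb]; ring)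
    (sqrt_mul_sqrt_le_mul_sqrt ha hs.le hk hak) (sqrt_mul_sqrt_le_mul_sqrt hb hs.le hk hbk) hD
  have hAL : √(a + s) ≤ √(s + k ^ 2) := Real.sqrt_le_sqrt (by linarith)
  have hBL : √(b + s) ≤ √(s + k ^ 2) := Real.sqrt_le_sqrt (by linarith)
  have hA0 := Real.sqrt_nonneg (a + s)
  have hB0 := Real.sqrt_nonneg (b + s)
  set A := √(a + s)
  set B := √(b + s)
  set L := √(s + k ^ 2)
  set D := a + b - 2 * c with hDdef
  set E := t * (1 - t) * D with hE
  have ht : 0 ≤ t * (1 - t) := mul_nonneg ht0 (by linarith)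
  have hD0 : 0 ≤ D := (sq_nonneg _).trans hD
  have hE0 : 0 ≤ E := mul_nonneg ht hD0
  have hPL : t * A + (1 - t) * B ≤ L := by
    linarith only [mul_le_mul_of_nonneg_left hAL ht0,
      mul_le_mul_of_nonneg_left hBL (sub_nonneg.2 ht1)]
  have hqL : s / (2 * L ^ 3) * E * (2 * L) = s * E / L ^ 2 := by field_simp
  have hgap : s * E / L ^ 2 ≤ t * (1 - t) * (D - (A - B) ^ 2) := by
    rw [div_le_iff₀ (by positivity)]
    have : s * D ≤ (D - (A - B) ^ 2) * L ^ 2 := by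
      rw [hL2] at hcontr ⊢
      linarith only [hcontr]
    linarith only [mul_le_mul_of_nonneg_left this ht, hE]
  set q := s / (2 * L ^ 3) * E
  have hq0 : 0 ≤ q := by positivity
  set P := t * A + (1 - t) * B with hP
  have hP0 : 0 ≤ P := add_nonneg (mul_nonneg ht0 hA0) (mul_nonneg (by linarith) hB0)
  have hP2 : t ^ 2 * a + (1 - t) ^ 2 * b + 2 * t * (1 - t) * c + s
      = P ^ 2 - t * (1 - t) * (D - (A - B) ^ 2) := by
    rw [hP, hDdef]
    linear_combination (-t) * hA2 - (1 - t) * hB2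
  have hM : √(t ^ 2 * a + (1 - t) ^ 2 * b + 2 * t * (1 - t) * c + s) ^ 2
      = P ^ 2 - t * (1 - t) * (D - (A - B) ^ 2) := by
    rw [← hP2]
    refine Real.sq_sqrt ?_
    have hsq : (t * √a - (1 - t) * √b) ^ 2 = t ^ 2 * a + (1 - t) ^ 2 * b
        - 2 * t * (1 - t) * (√a * √b) := by
      linear_combination t ^ 2 * Real.sq_sqrt ha + (1 - t) ^ 2 * Real.sq_sqrt hb
    have hcl : -(√a * √b) ≤ c := by
      rw [← Real.sqrt_mul ha]; exact (abs_le.1 (Real.abs_le_sqrt hc)).1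
    linarith only [mul_le_mul_of_nonneg_left hcl ht, hsq, hs, sq_nonneg (t * √a - (1 - t) * √b)]
  have hM0 := Real.sqrt_nonneg (t ^ 2 * a + (1 - t) ^ 2 * b + 2 * t * (1 - t) * c + s)
  set M := √(t ^ 2 * a + (1 - t) ^ 2 * b + 2 * t * (1 - t) * c + s)
  have hqM : q * (2 * L) ≤ P ^ 2 - M ^ 2 := by rw [hM]; linarith
  have hMP : M ≤ P := by
    refine (sq_le_sq₀ hM0 hP0).1 ?_
    linarith only [mul_nonneg hq0 hLpos.le, hqM]
  have : q * (2 * L) ≤ (P - M) * (2 * L) := by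
    linarith only [hqM, mul_le_mul_of_nonneg_left (by linarith : P + M ≤ 2 * L) (sub_nonneg.2 hMP)]
  linarith [le_of_mul_le_mul_right this (by positivity)]

theorem stmt19 (n m : ℕ) (hn : 0 < n) (hm : 0 < m) (σ δ : ℝ) (hσ : 0 < σ) (hδ : 0 < δ)
    (g : Fin m → ℝ) (hg : (Real.sqrt δ / 2) * Real.sqrt n ≤ Real.sqrt (∑ j, (g j) ^ 2))
    (h : Fin n → ℝ)
    (f : (Fin n → ℝ) → ℝ)
    (hf : ∀ w : Fin n → ℝ, f w =
      Real.sqrt ((∑ i, (w i) ^ 2) / n + σ ^ 2) * (Real.sqrt (∑ j, (g j) ^ 2) / Real.sqrt n)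
        - (1 / n) * ∑ i, h i * w i)
    (C : ℝ) (hC : C = σ ^ 2 * Real.sqrt δ / (2 * (σ ^ 2 + 4) ^ ((3 : ℝ) / 2))) :
    ∀ w w' : Fin n → ℝ, (∀ i, w i ∈ Set.Icc (-2 : ℝ) 0) → (∀ i, w' i ∈ Set.Icc (-2 : ℝ) 0) →
      ∀ t : ℝ, t ∈ Set.Icc (0 : ℝ) 1 →
        f (fun i => t * w i + (1 - t) * w' i)
          ≤ t * f w + (1 - t) * f w'
            - (C / (2 * n)) * t * (1 - t) * ∑ i, (w i - w' i) ^ 2 := by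
  intro w w' hw hw' t ⟨ht0, ht1⟩
  have hn' : (0 : ℝ) < n := Nat.cast_pos.2 hn
  have hbound : ∀ v : Fin n → ℝ, (∀ i, v i ∈ Set.Icc (-2 : ℝ) 0) →
      (∑ i, (v i) ^ 2) / n ≤ 2 ^ 2 := by
    intro v hv
    rw [div_le_iff₀ hn']
    calc ∑ i, (v i) ^ 2 ≤ ∑ _i : Fin n, (2 : ℝ) ^ 2 :=
          sum_le_sum fun i _ => by nlinarith [(hv i).1, (hv i).2]
      _ = 2 ^ 2 * n := by simp [mul_comm]
  have hcs : ((∑ i, w i * w' i) / n) ^ 2 ≤ (∑ i, (w i) ^ 2) / n * ((∑ i, (w' i) ^ 2) / n) := by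
    rw [div_pow, div_mul_div_comm, ← sq]
    gcongr
    exact sum_mul_sq_le_sq_mul_sq _ _ _
  have key := sqrt_add_le_sub_of_sq_le_mul (s := σ ^ 2) (k := 2) (t := t)
    (by positivity : 0 ≤ (∑ i, (w i) ^ 2) / n) (by positivity : 0 ≤ (∑ i, (w' i) ^ 2) / n)
    (by positivity) (by norm_num) (hbound w hw) (hbound w' hw') hcs ht0 ht1
  have hcomb : (∑ i, (t * w i + (1 - t) * w' i) ^ 2) / n = t ^ 2 * ((∑ i, (w i) ^ 2) / n)
      + (1 - t) ^ 2 * ((∑ i, (w' i) ^ 2) / n) + 2 * t * (1 - t) * ((∑ i, w i * w' i) / n) := by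
    simp only [mul_div_assoc', ← add_div, mul_sum, ← sum_add_distrib]
    congr 1
    exact sum_congr rfl fun i _ => by ring
  have hdist : (∑ i, (w i - w' i) ^ 2) / n = (∑ i, (w i) ^ 2) / n + (∑ i, (w' i) ^ 2) / n
      - 2 * ((∑ i, w i * w' i) / n) := by
    simp only [mul_div_assoc', ← add_div, ← sub_div, mul_sum, ← sum_add_distrib,
      ← sum_sub_distrib]
    congr 1
    exact sum_congr rfl fun i _ => by ring
  have hlin : ∑ i, h i * (t * w i + (1 - t) * w' i)
      = t * ∑ i, h i * w i + (1 - t) * ∑ i, h i * w' i := by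
    simp only [mul_sum, ← sum_add_distrib]
    exact sum_congr rfl fun i _ => by ring
  have hpow : (σ ^ 2 + 4) ^ ((3 : ℝ) / 2) = √(σ ^ 2 + 2 ^ 2) ^ 3 := by
    rw [Real.rpow_div_two_eq_sqrt _ (by positivity)]
    norm_num
  have hG : √δ / 2 ≤ √(∑ j, (g j) ^ 2) / √n := by
    rwa [le_div_iff₀ (Real.sqrt_pos.2 hn')]
  rw [← hcomb, ← hdist] at key
  have hE : 0 ≤ σ ^ 2 / (2 * √(σ ^ 2 + 2 ^ 2) ^ 3)
      * (t * (1 - t) * ((∑ i, (w i - w' i) ^ 2) / n)) := by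
    have : 0 ≤ 1 - t := by linarith
    positivity
  have hCeq : (C / (2 * n)) * t * (1 - t) * ∑ i, (w i - w' i) ^ 2
      = σ ^ 2 / (2 * √(σ ^ 2 + 2 ^ 2) ^ 3)
        * (t * (1 - t) * ((∑ i, (w i - w' i) ^ 2) / n)) * (√δ / 2) := by
    rw [hC, hpow]
    field_simp
  rw [hCeq, hf, hf, hf, hlin]
  have hG0 : 0 ≤ √(∑ j, (g j) ^ 2) / √n := by positivity
  linarith [mul_le_mul_of_nonneg_right key hG0, mul_le_mul_of_nonneg_left hG hE]
end
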